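/- For a plane real algebraic curve C hyperbolic with respect to a point e, and any point e' in the same connected component of ℝP² \ C as e that is also a hyperbolicity point, the straight segment (in a suitable affine chart) from e to e' consists entirely of hyperbolicity points. -/

import Mathlib

noncomputable section
noncomputable section

abbrev V3R := Fin 3 → ℝ
abbrev V3C := Fin 3 → ℂ

/-- Coordinatewise complexification of a real vector. -/
def cV (v : V3R) : V3C := fun i => (v i : ℂ)

lemma cV_ne_zero {v : V3R} (hv : v ≠ 0) : cV v ≠ 0 := fun h =>
  hv (funext fun i => by have := congrFun h i; simpa [cV] using this)

/-- The natural map ℝP² → ℂP². -/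
def toC (x : Projectivization ℝ V3R) : Projectivization ℂ V3C :=
  Projectivization.mk ℂ (cV x.rep) (cV_ne_zero x.rep_nonzero)

/-- A point of ℂP² is real if it comes from ℝP². -/
def IsRealPt (z : Projectivization ℂ V3C) : Prop := ∃ x, toC x = z

/-- Complexification of a real linear subspace. -/
def cplxSub (W : Submodule ℝ V3R) : Submodule ℂ V3C := Submodule.span ℂ (cV '' W)

/-- The real point set of the curve P = 0 in ℝP². -/
def Creal (P : MvPolynomial (Fin 3) ℝ) : Set (Projectivization ℝ V3R) :=
  {x | MvPolynomial.eval x.rep P = 0}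

/-- The complexification: the zero set of P in ℂP². -/
def Ccplx (P : MvPolynomial (Fin 3) ℝ) : Set (Projectivization ℂ V3C) :=
  {z | MvPolynomial.eval z.rep (P.map (algebraMap ℝ ℂ)) = 0}

/-- e is a hyperbolicity point of the plane curve P = 0: e is not on the curve and
every real projective line (2-dim subspace) through e meets the complexification
only in real points. -/
def HypPt (P : MvPolynomial (Fin 3) ℝ) (e : Projectivization ℝ V3R) : Prop :=
  e ∉ Creal P ∧
  ∀ W : Submodule ℝ V3R, Module.finrank ℝ W = 2 → e.submodule ≤ W →
    ∀ z ∈ Ccplx P, z.submodule ≤ cplxSub W → IsRealPt z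

def HypLocus (P : MvPolynomial (Fin 3) ℝ) : Set (Projectivization ℝ V3R) :=
  {e | HypPt P e}

/-- S ⊆ ℝP² is convex: it lies in an affine chart (the complement of the line f = 0)
and the corresponding set of normalized representatives (f v = 1) is convex. -/
def ConvexInChart (S : Set (Projectivization ℝ V3R)) : Prop :=
  ∃ f : V3R →ₗ[ℝ] ℝ, (∀ e ∈ S, f e.rep ≠ 0) ∧
    Convex ℝ {v : V3R | ∃ hv : v ≠ 0, f v = 1 ∧ Projectivization.mk ℝ v hv ∈ S}

/-- The hyperbolicity locus of a hyperbolic plane curve is convex in some affine chart. -/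

instance : TopologicalSpace (Projectivization ℝ V3R) :=
  inferInstanceAs (TopologicalSpace (Quotient (projectivizationSetoid ℝ V3R)))

lemma eval_smul_of_isHomogeneous {R : Type*} [CommRing R] {σ : Type*} [Fintype σ]
    {Q : MvPolynomial σ R} {d : ℕ} (hQ : Q.IsHomogeneous d) (c : R) (x : σ → R) :
    MvPolynomial.eval (c • x) Q = c ^ d * MvPolynomial.eval x Q := by
  rw [MvPolynomial.eval_eq', MvPolynomial.eval_eq', Finset.mul_sum]
  refine Finset.sum_congr rfl fun n hn => ?_
  have h := hQ (MvPolynomial.mem_support_iff.mp hn)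
  rw [Finsupp.weight_apply, Finsupp.sum_fintype _ _ (by simp)] at h
  simp only [Pi.one_apply, smul_eq_mul, mul_one] at h
  simp only [Pi.smul_apply, smul_eq_mul, mul_pow, Finset.prod_mul_distrib,
    Finset.prod_pow_eq_pow_sum, h]
  ring

open Polynomial in
lemma coeff_prod_affine_pow {R : Type*} [CommRing R] {σ : Type*} (s : Finset σ) (a b : σ → R)
    (n : σ → ℕ) :
    (∏ i ∈ s, (C (a i) + C (b i) * X) ^ n i).natDegree ≤ ∑ i ∈ s, n i ∧
    (∏ i ∈ s, (C (a i) + C (b i) * X) ^ n i).coeff (∑ i ∈ s, n i) = ∏ i ∈ s, b i ^ n i := by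
  classical
  have hlin (i : σ) : (C (a i) + C (b i) * X).natDegree ≤ 1 := by compute_degree
  have hpow (i : σ) : ((C (a i) + C (b i) * X) ^ n i).natDegree ≤ n i := by
    simpa using natDegree_pow_le_of_le (n i) (hlin i)
  induction s using Finset.induction_on with
  | empty => simp
  | insert j s hj ih =>
    rw [Finset.prod_insert hj, Finset.sum_insert hj, Finset.prod_insert hj]
    refine ⟨natDegree_mul_le_of_le (hpow j) ih.1, ?_⟩
    rw [coeff_mul_add_eq_of_natDegree_le (hpow j) ih.1, ih.2]
    have := coeff_pow_of_natDegree_le (m := n j) (hlin j)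
    rw [mul_one] at this
    simp [this]

open Polynomial in
/-- The restriction of a homogeneous polynomial to an affine line, as a univariate polynomial. -/
lemma exists_polynomial_eval_line {R : Type*} [CommRing R] {σ : Type*} [Fintype σ]
    {Q : MvPolynomial σ R} {d : ℕ} (hQ : Q.IsHomogeneous d) (a b : σ → R) :
    ∃ p : R[X], p.natDegree ≤ d ∧ p.coeff d = MvPolynomial.eval b Q ∧
      ∀ s, p.eval s = MvPolynomial.eval (a + s • b) Q := by
  refine ⟨∑ n ∈ Q.support, C (Q.coeff n) * ∏ i, (C (a i) + C (b i) * X) ^ n i, ?_, ?_, ?_⟩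
  · refine natDegree_sum_le_of_forall_le _ _ fun n hn => ?_
    have h := hQ (MvPolynomial.mem_support_iff.mp hn)
    rw [Finsupp.weight_apply, Finsupp.sum_fintype _ _ (by simp)] at h
    simp only [Pi.one_apply, smul_eq_mul, mul_one] at h
    rw [← h]
    exact (natDegree_C_mul_le _ _).trans (coeff_prod_affine_pow _ a b n).1
  · rw [finsetSum_coeff, MvPolynomial.eval_eq']
    refine Finset.sum_congr rfl fun n hn => ?_
    have h := hQ (MvPolynomial.mem_support_iff.mp hn)
    rw [Finsupp.weight_apply, Finsupp.sum_fintype _ _ (by simp)] at h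
    simp only [Pi.one_apply, smul_eq_mul, mul_one] at h
    rw [← h, coeff_C_mul, (coeff_prod_affine_pow _ a b n).2]
  · intro s
    rw [MvPolynomial.eval_eq', eval_finsetSum]
    refine Finset.sum_congr rfl fun n _ => ?_
    simp [eval_prod, mul_comm s]

open Topology Filter in
/-- Roots along a line persist under perturbation of the line's base point. -/
lemma eventually_exists_root_near {σ : Type*} [Fintype σ] {Q : MvPolynomial σ ℂ} {d : ℕ}
    (hQ : Q.IsHomogeneous d) {b : σ → ℂ} (hb : MvPolynomial.eval b Q ≠ 0) {a : σ → ℂ} {s₀ : ℂ}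
    (h : MvPolynomial.eval (a + s₀ • b) Q = 0) {ε : ℝ} (hε : 0 < ε) :
    ∀ᶠ a' in 𝓝 a, ∃ s, ‖s₀ - s‖ < ε ∧ MvPolynomial.eval (a' + s • b) Q = 0 := by
  have hc : Continuous fun a' : σ → ℂ => ‖MvPolynomial.eval (a' + s₀ • b) Q‖ :=
    ((MvPolynomial.continuous_eval Q).comp (by fun_prop)).norm
  have hpos : ‖MvPolynomial.eval (a + s₀ • b) Q‖ < ‖MvPolynomial.eval b Q‖ * ε ^ d := by
    rw [h, norm_zero]
    have := norm_pos_iff.mpr hb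
    positivity
  filter_upwards [hc.continuousAt.eventually (gt_mem_nhds hpos)] with a' ha'
  obtain ⟨p, hdeg, hlead, hp⟩ := exists_polynomial_eval_line hQ a' b
  have hd : p.natDegree = d :=
    le_antisymm hdeg (Polynomial.le_natDegree_of_ne_zero (by rwa [hlead]))
  by_contra! hfar
  have hsplit := IsAlgClosed.splits p
  have hprod : ε ^ Multiset.card p.roots ≤ (p.roots.map fun r => ‖s₀ - r‖).prod := by
    have : ∀ m : Multiset ℂ, (∀ r ∈ m, ε ≤ ‖s₀ - r‖) →
        ε ^ Multiset.card m ≤ (m.map fun r => ‖s₀ - r‖).prod := by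
      intro m
      induction m using Multiset.induction_on with
      | empty => simp
      | cons r m ih =>
        intro hm
        rw [Multiset.card_cons, Multiset.map_cons, Multiset.prod_cons, pow_succ']
        exact mul_le_mul (hm r (by simp)) (ih fun r hr => hm r (by simp [hr]))
          (by positivity) (norm_nonneg _)
    refine this _ fun r hr => ?_
    by_contra! hlt
    exact hfar r hlt (by rw [← hp]; exact Polynomial.isRoot_of_mem_roots hr)
  have heval : ‖p.eval s₀‖ = ‖p.leadingCoeff‖ * (p.roots.map fun r => ‖s₀ - r‖).prod := by
    rw [hsplit.eval_eq_prod_roots, norm_mul]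
    congr 1
    have := (p.roots.map fun r => s₀ - r).prod_hom (normHom : ℂ →*₀ ℝ)
    simpa using this.symm
  rw [← hp, heval, Polynomial.leadingCoeff, hd, hlead] at ha'
  rw [← hsplit.natDegree_eq_card_roots, hd] at hprod
  exact absurd ha' (not_lt.mpr (mul_le_mul_of_nonneg_left hprod (norm_nonneg _)))

/-- Roots along lines in a fixed non-vanishing direction are bounded by the base point. -/
lemma exists_root_bound {σ : Type*} [Fintype σ] {𝕜 : Type*} [RCLike 𝕜] {Q : MvPolynomial σ 𝕜}
    {d : ℕ} (hQ : Q.IsHomogeneous d) {b : σ → 𝕜} (hb : MvPolynomial.eval b Q ≠ 0) :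
    ∃ M > 0, ∀ (a : σ → 𝕜) (s : 𝕜), MvPolynomial.eval (a + s • b) Q = 0 → ‖s‖ ≤ M * ‖a‖ := by
  have hc := (MvPolynomial.continuous_eval Q).continuousAt.eventually_ne hb
  obtain ⟨δ, hδ, hball⟩ := Metric.eventually_nhds_iff.mp hc
  refine ⟨δ⁻¹, by positivity, fun a s h => ?_⟩
  by_contra! hlt
  have hs : s ≠ 0 := by
    rintro rfl
    rw [norm_zero] at hlt
    exact absurd hlt (not_lt.mpr (by positivity))
  have hspos := norm_pos_iff.mpr hs
  refine hball (y := s⁻¹ • a + b) ?_ ?_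
  · rw [dist_eq_norm, add_sub_cancel_right, norm_smul, norm_inv, inv_mul_lt_iff₀ hspos]
    rwa [inv_mul_lt_iff₀ hδ, mul_comm] at hlt
  · have : a + s • b = s • (s⁻¹ • a + b) := by
      rw [smul_add, smul_smul, mul_inv_cancel₀ hs, one_smul]
    rw [this, eval_smul_of_isHomogeneous hQ] at h
    exact (mul_eq_zero.mp h).resolve_left (pow_ne_zero _ hs)

/-- The evaluation of a real polynomial at a complex vector. -/
abbrev evalC (P : MvPolynomial (Fin 3) ℝ) (z : V3C) : ℂ :=
  MvPolynomial.eval z (P.map (algebraMap ℝ ℂ))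

lemma evalC_cV (P : MvPolynomial (Fin 3) ℝ) (v : V3R) :
    evalC P (cV v) = (MvPolynomial.eval v P : ℂ) := by
  rw [evalC, MvPolynomial.eval_map]
  exact (MvPolynomial.eval₂_comp_left (algebraMap ℝ ℂ) (RingHom.id ℝ) v P).symm

lemma evalC_conj (P : MvPolynomial (Fin 3) ℝ) (z : V3C) :
    evalC P (fun i => starRingEnd ℂ (z i)) = starRingEnd ℂ (evalC P z) := by
  rw [evalC, evalC, MvPolynomial.eval_map, MvPolynomial.eval_map, MvPolynomial.eval₂_comp_left]
  congr 1
  ext r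
  simp

lemma cV_add (v w : V3R) : cV (v + w) = cV v + cV w := by ext i; simp [cV]

lemma cV_smul (r : ℝ) (v : V3R) : cV (r • v) = (r : ℂ) • cV v := by ext i; simp [cV]

lemma continuous_cV : Continuous cV := by unfold cV; fun_prop

/-- `u` is a hyperbolicity vector of `P`: the restrictions of `P` to the affine lines in
direction `u` are real-rooted of full degree. -/
def IsHypVec (P : MvPolynomial (Fin 3) ℝ) (u : V3R) : Prop :=
  MvPolynomial.eval u P ≠ 0 ∧ ∀ (v : V3R) (t : ℂ), evalC P (cV v + t • cV u) = 0 → t.im = 0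

/-- Gårding's hyperbolicity cone of `P` in direction `u`. -/
def hypCone (P : MvPolynomial (Fin 3) ℝ) (u : V3R) : Set V3R :=
  {w | ∀ t : ℝ, 0 ≤ t → MvPolynomial.eval (w + t • u) P ≠ 0}

section Garding

variable {P : MvPolynomial (Fin 3) ℝ} {d : ℕ} {u v w : V3R}

lemma eval_ne_zero_of_mem_hypCone (hw : w ∈ hypCone P u) : MvPolynomial.eval w P ≠ 0 := by
  simpa using hw 0 le_rfl

lemma smul_mem_hypCone (hP : P.IsHomogeneous d) (hw : w ∈ hypCone P u) {c : ℝ} (hc : 0 < c) :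
    c • w ∈ hypCone P u := by
  intro t ht
  have h : c • w + t • u = c • (w + (c⁻¹ * t) • u) := by
    rw [smul_add, smul_smul, mul_inv_cancel_left₀ hc.ne']
  rw [h, eval_smul_of_isHomogeneous hP]
  exact mul_ne_zero (pow_ne_zero _ hc.ne') (hw _ (by positivity))

lemma segment_subset_hypCone (hP : P.IsHomogeneous d) (hu : MvPolynomial.eval u P ≠ 0)
    (hw : w ∈ hypCone P u) : segment ℝ u w ⊆ hypCone P u := by
  rintro _ ⟨a, b, ha, hb, hab, rfl⟩ t ht
  rcases hb.eq_or_lt with rfl | hb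
  · have h : a • u + (0 : ℝ) • w + t • u = (a + t) • u := by module
    rw [h, eval_smul_of_isHomogeneous hP]
    exact mul_ne_zero (pow_ne_zero _ (by linarith)) hu
  · have h : a • u + b • w + t • u = b • w + (a + t) • u := by module
    rw [h]
    exact smul_mem_hypCone hP hw hb _ (by positivity)

lemma evalC_homogeneous (hP : P.IsHomogeneous d) (c : ℂ) (z : V3C) :
    evalC P (c • z) = c ^ d * evalC P z :=
  eval_smul_of_isHomogeneous (hP.map _) c z

open Topology Filter Complex in
lemma im_neg_of_mem_hypCone (hP : P.IsHomogeneous d) (hu : IsHypVec P u) (hw : w ∈ hypCone P u)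
    {α : ℝ} (hα : 0 < α) {s : ℂ} (hs : evalC P (cV v + (α * I) • cV u + s • cV w) = 0) :
    s.im < 0 := by
  by_contra! hs0
  have hw0 : evalC P (cV w) ≠ 0 := by
    rw [evalC_cV]
    exact_mod_cast eval_ne_zero_of_mem_hypCone hw
  obtain ⟨M, hM, hbound⟩ := exists_root_bound (hP.map (algebraMap ℝ ℂ)) hw0
  set a : ℝ → V3C := fun β => (β : ℂ) • cV v + (α * I) • cV u with ha
  have hac : Continuous a := by fun_prop
  set K : ℝ := ‖cV v‖ + ‖(α * I) • cV u‖
  let Z : Set (ℝ × ℂ) := {x | x ∈ Set.Icc (0 : ℝ) 1 ×ˢ Metric.closedBall (0 : ℂ) (M * K) ∧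
    0 ≤ x.2.im ∧ evalC P (a x.1 + x.2 • cV w) = 0}
  have hmem : ∀ β ∈ Set.Icc (0 : ℝ) 1, ∀ t : ℂ, 0 ≤ t.im → evalC P (a β + t • cV w) = 0 →
      (β, t) ∈ Z := by
    intro β hβ t ht h
    refine ⟨⟨hβ, ?_⟩, ht, h⟩
    rw [mem_closedBall_zero_iff]
    refine (hbound _ _ h).trans (mul_le_mul_of_nonneg_left ?_ hM.le)
    refine (norm_add_le _ _).trans (add_le_add_left ?_ _)
    rw [norm_smul, norm_real, Real.norm_of_nonneg hβ.1]
    exact mul_le_of_le_one_left (norm_nonneg _) hβ.2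
  have hZ : IsCompact Z := by
    refine (isCompact_Icc.prod (isCompact_closedBall _ _)).inter_right ?_
    refine (isClosed_le continuous_const (continuous_im.comp continuous_snd)).inter
      (isClosed_eq ((MvPolynomial.continuous_eval _).comp ?_) continuous_const)
    fun_prop
  have hne : Z.Nonempty := ⟨(1, s), hmem 1 (by simp) s hs0 (by simpa [ha] using hs)⟩
  obtain ⟨⟨β, t⟩, ⟨⟨hβ, -⟩, ht, hroot⟩, hmin⟩ := hZ.exists_isMinOn hne continuous_fst.continuousOn
  simp only at hβ ht hroot
  have htpos : 0 < t.im := by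
    refine ht.lt_of_ne fun h0 => hα.ne' ?_
    have htr : ((t.re : ℝ) : ℂ) = t := Complex.ext (by simp) (by simpa using h0)
    have h := hu.2 (β • v + t.re • w) (α * I) (by
      rw [cV_add, cV_smul, cV_smul, htr, ← hroot, ha]
      congr 1
      module)
    simpa using h
  have ht0 : t ≠ 0 := by
    rintro rfl
    simp at htpos
  have hβpos : 0 < β := by
    refine hβ.1.lt_of_ne ?_
    rintro rfl
    have h1 : evalC P (cV w + (α * I / t) • cV u) = 0 := by
      have h : a 0 + t • cV w = t • (cV w + (α * I / t) • cV u) := by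
        simp only [ha, smul_add, smul_smul, mul_div_cancel₀ _ ht0, ofReal_zero, zero_smul,
          zero_add]
        exact add_comm _ _
      rw [h, evalC_homogeneous hP] at hroot
      exact (mul_eq_zero.mp hroot).resolve_left (pow_ne_zero _ ht0)
    have him := hu.2 _ _ h1
    obtain ⟨r, hr⟩ : ∃ r : ℝ, α * I / t = r :=
      ⟨(α * I / t).re, Complex.ext (by simp) (by simpa using him)⟩
    rw [hr, ← cV_smul, ← cV_add, evalC_cV, ofReal_eq_zero] at h1
    have hrneg : r < 0 := by
      by_contra! h
      exact hw r h h1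
    rw [div_eq_iff ht0] at hr
    have := congrArg Complex.im hr
    simp at this
    nlinarith
  have hnear := (hac.tendsto β).eventually
    (eventually_exists_root_near (hP.map (algebraMap ℝ ℂ)) hw0 hroot htpos)
  obtain ⟨β', ⟨t', ht', hroot'⟩, hβ'⟩ := ((hnear.filter_mono nhdsWithin_le_nhds).and
    (Ioo_mem_nhdsLT hβpos)).exists
  have h1 := abs_im_le_norm (t - t')
  have h2 := le_abs_self (t - t').im
  rw [sub_im] at h1 h2
  have h3 := hmin (hmem β' ⟨hβ'.1.le, hβ'.2.le.trans hβ.2⟩ t' (by linarith) hroot')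
  exact absurd hβ'.2 (not_lt.mpr h3)

open Topology Filter Complex in
/-- Every vector of the hyperbolicity cone is a hyperbolicity vector (Gårding). -/
lemma isHypVec_of_mem_hypCone (hP : P.IsHomogeneous d) (hu : IsHypVec P u)
    (hw : w ∈ hypCone P u) : IsHypVec P w := by
  have hw0 := eval_ne_zero_of_mem_hypCone hw
  have hwC : evalC P (cV w) ≠ 0 := by
    rw [evalC_cV]
    exact_mod_cast hw0
  have key : ∀ (v : V3R) (t : ℂ), evalC P (cV v + t • cV w) = 0 → t.im ≤ 0 := by
    intro v t h
    by_contra! ht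
    have hc : Continuous fun α : ℝ => cV v + ((α : ℂ) * I) • cV u := by fun_prop
    have h0 : cV v + (((0 : ℝ) : ℂ) * I) • cV u = cV v := by simp
    have hnear := (hc.tendsto 0).eventually (by
      rw [h0]
      exact eventually_exists_root_near (hP.map (algebraMap ℝ ℂ)) hwC h ht)
    obtain ⟨α, ⟨s, hs, hroot⟩, hα⟩ := ((hnear.filter_mono nhdsWithin_le_nhds).and
      (self_mem_nhdsWithin : Set.Ioi (0 : ℝ) ∈ 𝓝[>] 0)).exists
    have h1 := abs_im_le_norm (t - s)
    have h2 := le_abs_self (t - s).im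
    rw [sub_im] at h1 h2
    linarith [im_neg_of_mem_hypCone hP hu hw hα hroot]
  refine ⟨hw0, fun v t h => le_antisymm (key v t h) ?_⟩
  have h' := key v (starRingEnd ℂ t) (by
    have := evalC_conj P (cV v + t • cV w)
    rw [h, map_zero] at this
    rw [← this]
    congr 1
    ext i
    simp [cV])
  rw [conj_im] at h'
  linarith

open Topology Filter in
lemma isOpen_hypCone (hP : P.IsHomogeneous d) (hu : MvPolynomial.eval u P ≠ 0) :
    IsOpen (hypCone P u) := by
  rw [isOpen_iff_mem_nhds]
  intro w hw
  obtain ⟨M, hM, hbound⟩ := exists_root_bound hP hu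
  have hev : ∀ᶠ w' in 𝓝 w, ∀ t ∈ Set.Icc (0 : ℝ) (M * (‖w‖ + 1)),
      MvPolynomial.eval (w' + t • u) P ≠ 0 := by
    refine isCompact_Icc.eventually_forall_of_forall_eventually fun t ht => ?_
    have hc : Continuous fun z : V3R × ℝ => MvPolynomial.eval (z.1 + z.2 • u) P :=
      (MvPolynomial.continuous_eval P).comp (by fun_prop)
    exact hc.continuousAt.eventually_ne (hw t ht.1)
  filter_upwards [hev, Metric.ball_mem_nhds w one_pos] with w' h1 h2 t ht h
  refine h1 t ⟨ht, (le_abs_self t).trans ((hbound _ _ h).trans ?_)⟩ h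
  gcongr
  rw [mem_ball_iff_norm] at h2
  linarith [norm_le_norm_add_norm_sub' w' w]

open Topology Filter Complex in
lemma isOpen_compl_hypCone (hP : P.IsHomogeneous d) (hu : IsHypVec P u) :
    IsOpen {w | MvPolynomial.eval w P ≠ 0 ∧ w ∉ hypCone P u} := by
  rw [isOpen_iff_mem_nhds]
  rintro w ⟨hw0, hw⟩
  have huC : evalC P (cV u) ≠ 0 := by
    rw [evalC_cV]
    exact_mod_cast hu.1
  obtain ⟨t, ht, hroot⟩ : ∃ t : ℝ, 0 ≤ t ∧ MvPolynomial.eval (w + t • u) P = 0 := by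
    simpa [hypCone] using hw
  have htpos : 0 < t := ht.lt_of_ne (by
    rintro rfl
    simp [hw0] at hroot)
  have hrootC : evalC P (cV w + (t : ℂ) • cV u) = 0 := by
    rw [← cV_smul, ← cV_add, evalC_cV, hroot, ofReal_zero]
  have hnear := (continuous_cV.tendsto w).eventually
    (eventually_exists_root_near (hP.map (algebraMap ℝ ℂ)) huC hrootC htpos)
  filter_upwards [hnear, (MvPolynomial.continuous_eval P).continuousAt.eventually_ne hw0]
    with w' ⟨s, hs, hs'⟩ hw'
  refine ⟨hw', fun hcone => ?_⟩
  have him := hu.2 _ _ hs'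
  obtain ⟨r, rfl⟩ : ∃ r : ℝ, s = r := ⟨s.re, Complex.ext (by simp) (by simpa using him)⟩
  rw [← ofReal_sub, norm_real, Real.norm_eq_abs] at hs
  refine hcone r (by linarith [le_abs_self (t - r)]) ?_
  rw [← cV_smul, ← cV_add] at hs'
  exact_mod_cast (evalC_cV P _).symm.trans hs'

end Garding

section Projective

variable {P : MvPolynomial (Fin 3) ℝ} {d : ℕ}

lemma mem_cplxSub {W : Submodule ℝ V3R} {u v : V3R} (hW : W ≤ Submodule.span ℝ {u, v})
    {z : V3C} (hz : z ∈ cplxSub W) : ∃ p q : ℂ, p • cV u + q • cV v = z := by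
  rw [← Submodule.mem_span_pair]
  refine Submodule.span_le.mpr ?_ hz
  rintro _ ⟨x, hx, rfl⟩
  obtain ⟨a, b, rfl⟩ := Submodule.mem_span_pair.mp (hW hx)
  rw [cV_add, cV_smul, cV_smul]
  exact Submodule.mem_span_pair.mpr ⟨a, b, rfl⟩

lemma isRealPt_of_rep_eq_smul {z : Projectivization ℂ V3C} {c : ℂ} {x : V3R}
    (h : z.rep = c • cV x) : IsRealPt z := by
  have hx : x ≠ 0 := by
    rintro rfl
    exact z.rep_nonzero (h.trans (by ext; simp [cV]))
  obtain ⟨a, ha⟩ := Projectivization.exists_smul_eq_mk_rep ℝ x hx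
  refine ⟨Projectivization.mk ℝ x hx, ?_⟩
  rw [← z.mk_rep, toC, Projectivization.mk_eq_mk_iff']
  have hc : c ≠ 0 := by
    rintro rfl
    exact z.rep_nonzero (by simpa using h)
  have ha' : cV (Projectivization.mk ℝ x hx).rep = ((a : ℝ) : ℂ) • cV x := by
    rw [← ha, ← cV_smul]
    rfl
  refine ⟨(a : ℝ) / c, ?_⟩
  rw [h, ha', smul_smul, div_mul_cancel₀ _ hc]

lemma isHypVec_rep (hP : P.IsHomogeneous d) {e : Projectivization ℝ V3R} (he : HypPt P e) :
    IsHypVec P e.rep := by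
  refine ⟨he.1, fun v t h => ?_⟩
  by_contra ht
  have hu := e.rep_nonzero
  set u := e.rep with hu_def
  have hv : v ∉ Submodule.span ℝ {u} := by
    intro hv
    obtain ⟨k, rfl⟩ := Submodule.mem_span_singleton.mp hv
    rw [cV_smul, ← add_smul, evalC_homogeneous hP, evalC_cV] at h
    refine mul_ne_zero (pow_ne_zero _ fun h0 => ht ?_) (Complex.ofReal_ne_zero.mpr he.1) h
    simpa using congrArg Complex.im h0
  have hz : cV v + t • cV u ≠ 0 := by
    intro h0
    refine hu (funext fun i => ?_)
    have := congrArg Complex.im (congrFun h0 i)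
    simpa [cV, ht] using this
  obtain ⟨a, ha⟩ := Projectivization.exists_smul_eq_mk_rep ℂ _ hz
  have hLI : LinearIndependent ℝ ![u, v] := by
    rw [LinearIndependent.pair_iff' hu]
    exact fun k hk => hv (Submodule.mem_span_singleton.mpr ⟨k, hk⟩)
  obtain ⟨x, hx⟩ := he.2 (Submodule.span ℝ (Set.range ![u, v]))
    (by rw [finrank_span_eq_card hLI]; simp)
    (by
      rw [e.submodule_eq, ← hu_def]
      exact Submodule.span_mono (by simp))
    (Projectivization.mk ℂ _ hz)
    (by
      change evalC P _ = 0
      rw [← ha]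
      exact (evalC_homogeneous hP (a : ℂ) _).trans (by rw [h, mul_zero]))
    (by
      rw [Projectivization.submodule_mk, Submodule.span_singleton_le_iff_mem]
      refine Submodule.add_mem _ ?_ (Submodule.smul_mem _ _ ?_) <;>
      exact Submodule.subset_span (Set.mem_image_of_mem _ (Submodule.subset_span (by simp))))
  rw [toC, Projectivization.mk_eq_mk_iff'] at hx
  obtain ⟨c, hc⟩ := hx
  have hc0 : c ≠ 0 := by
    rintro rfl
    exact cV_ne_zero x.rep_nonzero (by simpa using hc.symm)
  have hz' : cV v + t • cV u = c⁻¹ • cV x.rep := by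
    rw [← hc, smul_smul, inv_mul_cancel₀ hc0, one_smul]
  have him : t.im • u = (c⁻¹).im • x.rep := by
    ext i
    simpa [cV] using congrArg Complex.im (congrFun hz' i)
  have hre : v + t.re • u = (c⁻¹).re • x.rep := by
    ext i
    simpa [cV] using congrArg Complex.re (congrFun hz' i)
  have hcim : (c⁻¹).im ≠ 0 := fun h0 => by
    rw [h0, zero_smul] at him
    exact (smul_ne_zero ht hu) him
  refine hv (Submodule.mem_span_singleton.mpr ⟨(c⁻¹).re * ((c⁻¹).im⁻¹ * t.im) - t.re, ?_⟩)
  rw [sub_smul, mul_smul, mul_smul, him, smul_smul _ (c⁻¹).im, inv_mul_cancel₀ hcim, one_smul,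
    ← hre, add_sub_cancel_right]

lemma hypPt_mk (hP : P.IsHomogeneous d) {w : V3R} (hw0 : w ≠ 0) (hw : IsHypVec P w) :
    HypPt P (Projectivization.mk ℝ w hw0) := by
  constructor
  · obtain ⟨a, ha⟩ := Projectivization.exists_smul_eq_mk_rep ℝ w hw0
    change MvPolynomial.eval _ P ≠ 0
    rw [← ha]
    exact (eval_smul_of_isHomogeneous hP (a : ℝ) w).trans_ne
      (mul_ne_zero (pow_ne_zero _ a.ne_zero) hw.1)
  · intro W hW hle z hz hzW
    rw [Projectivization.submodule_mk, Submodule.span_singleton_le_iff_mem] at hle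
    obtain ⟨v, hvW, hv⟩ : ∃ v ∈ W, v ∉ Submodule.span ℝ {w} := by
      by_contra! h
      have := Submodule.finrank_mono (h : W ≤ Submodule.span ℝ {w})
      rw [hW, finrank_span_singleton hw0] at this
      omega
    have hLI : LinearIndependent ℝ ![w, v] := by
      rw [LinearIndependent.pair_iff' hw0]
      exact fun k hk => hv (Submodule.mem_span_singleton.mpr ⟨k, hk⟩)
    have hspan : Submodule.span ℝ {w, v} = W := by
      refine Submodule.eq_of_le_of_finrank_eq ?_ ?_
      · rw [Submodule.span_le, Set.insert_subset_iff, Set.singleton_subset_iff]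
        exact ⟨hle, hvW⟩
      · have := finrank_span_eq_card hLI
        rw [Matrix.range_cons, Matrix.range_cons, Matrix.range_empty, Set.union_empty,
          Set.singleton_union] at this
        rw [this, hW]
        simp
    rw [z.submodule_eq, Submodule.span_singleton_le_iff_mem] at hzW
    obtain ⟨p, q, hpq⟩ := mem_cplxSub hspan.ge hzW
    by_cases hq : q = 0
    · exact isRealPt_of_rep_eq_smul (c := p) (x := w) (by rw [← hpq, hq, zero_smul, add_zero])
    have hfac : z.rep = q • (cV v + (p / q) • cV w) := by
      rw [← hpq, smul_add, smul_smul, mul_div_cancel₀ _ hq, add_comm]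
    have hroot : evalC P (cV v + (p / q) • cV w) = 0 := by
      have h : evalC P z.rep = 0 := hz
      rw [hfac, evalC_homogeneous hP] at h
      exact (mul_eq_zero.mp h).resolve_left (pow_ne_zero _ hq)
    have hreal : (((p / q).re : ℝ) : ℂ) = p / q :=
      Complex.ext (by simp) (by simpa using (hw.2 _ _ hroot).symm)
    refine isRealPt_of_rep_eq_smul (c := q) (x := v + (p / q).re • w) ?_
    rw [hfac, cV_add, cV_smul, hreal]

lemma isOpen_setOf_rep_mem {S : Set V3R} (hS : IsOpen S)
    (hsmul : ∀ c : ℝ, c ≠ 0 → ∀ v ∈ S, c • v ∈ S) :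
    IsOpen {x : Projectivization ℝ V3R | x.rep ∈ S} := by
  refine isOpen_coinduced.mpr ?_
  convert hS.preimage (continuous_subtype_val (p := fun v : V3R => v ≠ 0)) using 1
  ext v
  obtain ⟨a, ha⟩ := Projectivization.exists_smul_eq_mk_rep ℝ v.1 v.2
  change (Projectivization.mk ℝ v.1 v.2).rep ∈ S ↔ v.1 ∈ S
  rw [← ha]
  refine ⟨fun h => ?_, hsmul a a.ne_zero _⟩
  have := hsmul (a⁻¹ : ℝ) (inv_ne_zero a.ne_zero) _ h
  rwa [Units.smul_def, smul_smul, inv_mul_cancel₀ a.ne_zero, one_smul] at this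

lemma smul_mem_or_neg_mem_hypCone (hP : P.IsHomogeneous d) {u v : V3R} {c : ℝ} (hc : c ≠ 0)
    (h : v ∈ hypCone P u ∨ -v ∈ hypCone P u) :
    c • v ∈ hypCone P u ∨ -(c • v) ∈ hypCone P u := by
  rcases hc.lt_or_gt with hc | hc
  · rcases h with h | h
    · exact .inr (by simpa using smul_mem_hypCone hP h (neg_pos.mpr hc))
    · exact .inl (by simpa using smul_mem_hypCone hP h (neg_pos.mpr hc))
  · rcases h with h | h
    · exact .inl (smul_mem_hypCone hP h hc)
    · exact .inr (by simpa using smul_mem_hypCone hP h hc)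

/-- A point in the component of a hyperbolicity point `e` lifts, up to sign, to the
hyperbolicity cone of `e`. -/
lemma rep_mem_or_neg_rep_mem_hypCone (hP : P.IsHomogeneous d) {e e' : Projectivization ℝ V3R}
    (he : HypPt P e) (hcomp : e' ∈ connectedComponentIn {x | x ∉ Creal P} e) :
    e'.rep ∈ hypCone P e.rep ∨ -e'.rep ∈ hypCone P e.rep := by
  have hu := isHypVec_rep hP he
  generalize hΛ_def : hypCone P e.rep = Λ
  have hself : e.rep ∈ Λ := by
    rw [← hΛ_def]
    intro t ht
    have h : e.rep + t • e.rep = (1 + t) • e.rep := by module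
    rw [h, eval_smul_of_isHomogeneous hP]
    exact mul_ne_zero (pow_ne_zero _ (by positivity)) hu.1
  have hΛ : IsOpen Λ := hΛ_def ▸ isOpen_hypCone hP hu.1
  have hΛc : IsOpen {w | MvPolynomial.eval w P ≠ 0 ∧ w ∉ Λ} := hΛ_def ▸ isOpen_compl_hypCone hP hu
  have hneg (v : V3R) : MvPolynomial.eval (-v) P ≠ 0 ↔ MvPolynomial.eval v P ≠ 0 := by
    rw [← neg_one_smul ℝ v, eval_smul_of_isHomogeneous hP]
    simp
  have hsmul (c : ℝ) (hc : c ≠ 0) (v : V3R) (hv : v ∈ Λ ∨ -v ∈ Λ) : c • v ∈ Λ ∨ -(c • v) ∈ Λ := by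
    subst hΛ_def
    exact smul_mem_or_neg_mem_hypCone hP hc hv
  have hopen₁ : IsOpen {x : Projectivization ℝ V3R | x.rep ∈ {v | v ∈ Λ ∨ -v ∈ Λ}} :=
    isOpen_setOf_rep_mem (hΛ.union (hΛ.preimage continuous_neg))
      hsmul
  have hopen₂ : IsOpen {x : Projectivization ℝ V3R |
      x.rep ∈ {v | MvPolynomial.eval v P ≠ 0 ∧ ¬(v ∈ Λ ∨ -v ∈ Λ)}} := by
    refine isOpen_setOf_rep_mem ?_ fun c hc v hv => ⟨?_, fun h => hv.2 ?_⟩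
    · convert hΛc.inter (hΛc.preimage continuous_neg) using 1
      ext v
      have := hneg v
      simp only [Set.mem_ofPred_eq, Set.mem_inter_iff, Set.mem_preimage]
      tauto
    · rw [eval_smul_of_isHomogeneous hP]
      exact mul_ne_zero (pow_ne_zero _ hc) hv.1
    · simpa [smul_smul, hc] using hsmul _ (inv_ne_zero hc) _ h
  refine isPreconnected_connectedComponentIn.subset_left_of_subset_union hopen₁ hopen₂ ?_ ?_
    ⟨e, mem_connectedComponentIn he.1, .inl hself⟩ hcomp
  · exact Set.disjoint_left.mpr fun x h₁ h₂ => h₂.2 h₁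
  · intro x hx
    have hxP : MvPolynomial.eval x.rep P ≠ 0 := connectedComponentIn_subset _ _ hx
    by_cases h : x.rep ∈ Λ ∨ -x.rep ∈ Λ
    · exact .inl h
    · exact .inr ⟨hxP, h⟩

lemma exists_linearMap_eq_one {K V : Type*} [Field K] [AddCommGroup V] [Module K V] {u w : V}
    (hu : u ≠ 0) (hw : w = u ∨ w ∉ Submodule.span K {u}) :
    ∃ f : V →ₗ[K] K, f u = 1 ∧ f w = 1 := by
  have hnot : u ∉ Submodule.span K {w - u} := by
    intro h
    obtain ⟨k, hk⟩ := Submodule.mem_span_singleton.mp h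
    rcases hw with rfl | hw
    · exact hu (by simpa using hk.symm)
    · have hk0 : k ≠ 0 := by
        rintro rfl
        exact hu (by simpa using hk.symm)
      refine hw (Submodule.mem_span_singleton.mpr ⟨k⁻¹ + 1, ?_⟩)
      rw [add_smul, one_smul]
      nth_rewrite 1 [← hk]
      rw [smul_smul, inv_mul_cancel₀ hk0, one_smul, sub_add_cancel]
  obtain ⟨g, hg, hker⟩ := Submodule.exists_le_ker_of_notMem hnot
  have hgw : g w = g u := by
    have : g (w - u) = 0 := hker (Submodule.mem_span_singleton_self _)
    rwa [map_sub, sub_eq_zero] at this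
  exact ⟨(g u)⁻¹ • g, by simp [hg], by simp [hgw, hg]⟩

end Projective

/-- If e and e' are hyperbolicity points of the plane curve P = 0 lying in the same
connected component of ℝP² \ C, then in a suitable affine chart the straight segment
from e to e' consists entirely of hyperbolicity points. -/
theorem segment_of_hyperbolicity_points (P : MvPolynomial (Fin 3) ℝ) (d : ℕ)
    (hP0 : P ≠ 0) (hPh : P.IsHomogeneous d)
    (e e' : Projectivization ℝ V3R) (he : HypPt P e) (he' : HypPt P e')
    (hcomp : e' ∈ connectedComponentIn {x | x ∉ Creal P} e) :
    ∃ (f : V3R →ₗ[ℝ] ℝ) (u w : V3R) (hu : u ≠ 0) (hw : w ≠ 0),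
      f u = 1 ∧ f w = 1 ∧
      Projectivization.mk ℝ u hu = e ∧ Projectivization.mk ℝ w hw = e' ∧
      ∀ v ∈ segment ℝ u w, ∃ hv : v ≠ 0, HypPt P (Projectivization.mk ℝ v hv) := by
  have hu := isHypVec_rep hPh he
  obtain ⟨w, hw0, hwe, hwΛ⟩ : ∃ (w : V3R) (hw : w ≠ 0),
      Projectivization.mk ℝ w hw = e' ∧ w ∈ hypCone P e.rep := by
    rcases rep_mem_or_neg_rep_mem_hypCone hPh he hcomp with h | h
    · exact ⟨e'.rep, e'.rep_nonzero, e'.mk_rep, h⟩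
    · refine ⟨-e'.rep, neg_ne_zero.mpr e'.rep_nonzero, ?_, h⟩
      conv_rhs => rw [← e'.mk_rep]
      exact (Projectivization.mk_eq_mk_iff' ..).mpr ⟨-1, by simp⟩
  obtain ⟨w, hw0, hwe, hwΛ, hwu⟩ : ∃ (w : V3R) (hw : w ≠ 0),
      Projectivization.mk ℝ w hw = e' ∧ segment ℝ e.rep w ⊆ hypCone P e.rep ∧
      (w = e.rep ∨ w ∉ Submodule.span ℝ {e.rep}) := by
    have hseg := segment_subset_hypCone hPh hu.1 hwΛ
    by_cases hmem : w ∈ Submodule.span ℝ {e.rep}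
    · refine ⟨e.rep, e.rep_nonzero, ?_, ?_, .inl rfl⟩
      · rw [← hwe, eq_comm, Projectivization.mk_eq_mk_iff']
        exact Submodule.mem_span_singleton.mp hmem
      · rw [segment_same, Set.singleton_subset_iff]
        exact hseg (left_mem_segment ℝ _ _)
    · exact ⟨w, hw0, hwe, hseg, .inr hmem⟩
  obtain ⟨f, hfu, hfw⟩ := exists_linearMap_eq_one e.rep_nonzero hwu
  refine ⟨f, e.rep, w, e.rep_nonzero, hw0, hfu, hfw, e.mk_rep, hwe, fun v hv => ?_⟩
  have hfv : f v = 1 := by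
    obtain ⟨a, b, -, -, hab, rfl⟩ := hv
    simp [hfu, hfw, hab]
  have hv0 : v ≠ 0 := by
    rintro rfl
    simp at hfv
  exact ⟨hv0, hypPt_mk hPh hv0 (isHypVec_of_mem_hypCone hPh hu (hwΛ hv))⟩
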